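/- Let (a₀,a₁,a₂) and (b₀,b₁,b₂) be orthonormal bases of ℝ³, set A_i = a_i·σ and B_i = b_i·σ, let π be any permutation of {0,1,2} and let ε₀,ε₁,ε₂ ∈ {−1,1}. Then for every separable two-qubit density matrix ρ = ∑_λ p_λ (ρ_A^λ ⊗ ρ_B^λ) (finite sum, p_λ ≥ 0 summing to 1, each factor a 2×2 density matrix, ⊗ the Kronecker product) one has |Re Tr((∑_{i=0}^{2} ε_i · A_i ⊗ B_{π(i)}) * ρ)| ≤ 1. -/

import Mathlib

open Matrix ComplexOrder Kronecker

/-- The Pauli matrices. -/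
noncomputable def pauli1 : Matrix (Fin 2) (Fin 2) ℂ := !![0, 1; 1, 0]
noncomputable def pauli2 : Matrix (Fin 2) (Fin 2) ℂ := !![0, -Complex.I; Complex.I, 0]
noncomputable def pauli3 : Matrix (Fin 2) (Fin 2) ℂ := !![1, 0; 0, -1]

/-- `n·σ` for `n ∈ ℝ³`. -/
noncomputable def dotSigma (n : EuclideanSpace ℝ (Fin 3)) : Matrix (Fin 2) (Fin 2) ℂ :=
  (n 0 : ℂ) • pauli1 + (n 1 : ℂ) • pauli2 + (n 2 : ℂ) • pauli3

/-- A density matrix: positive semidefinite with unit trace. -/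
def IsDensityMatrix {d : Type*} [Fintype d] [DecidableEq d]
    (ρ : Matrix d d ℂ) : Prop :=
  ρ.PosSemidef ∧ ρ.trace = 1

/-- A separable two-qubit density matrix: a finite convex combination of Kronecker
products of qubit density matrices. -/
def IsSeparableTwoQubit (ρ : Matrix (Fin 2 × Fin 2) (Fin 2 × Fin 2) ℂ) : Prop :=
  ∃ (n : ℕ) (p : Fin n → ℝ) (ρA ρB : Fin n → Matrix (Fin 2) (Fin 2) ℂ),
    (∀ k, 0 ≤ p k) ∧ (∑ k, p k = 1) ∧
    (∀ k, IsDensityMatrix (ρA k)) ∧ (∀ k, IsDensityMatrix (ρB k)) ∧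
    ρ = ∑ k, (p k : ℂ) • (ρA k ⊗ₖ ρB k)

/-- The Bloch vector of a qubit density matrix: it has norm at most one and gives the expectation
of every `n·σ`. -/
lemma IsDensityMatrix.exists_bloch_vector {ρ : Matrix (Fin 2) (Fin 2) ℂ}
    (hρ : IsDensityMatrix ρ) :
    ∃ r : EuclideanSpace ℝ (Fin 3), ‖r‖ ≤ 1 ∧
      ∀ n, (dotSigma n * ρ).trace = ((inner ℝ n r : ℝ) : ℂ) := by
  obtain ⟨hpos, htr⟩ := hρ
  have h00 := hpos.isHermitian.apply 0 0
  have h11 := hpos.isHermitian.apply 1 1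
  have h10 := hpos.isHermitian.apply 1 0
  have hdet := hpos.det_nonneg
  rw [det_fin_two, Complex.le_def] at hdet
  rw [trace_fin_two] at htr
  simp only [Complex.ext_iff, Complex.star_def, Complex.conj_re, Complex.conj_im,
    Complex.add_re, Complex.add_im, Complex.one_re, Complex.one_im] at h00 h11 h10 htr
  simp only [Complex.sub_re, Complex.mul_re, Complex.zero_re] at hdet
  have i00 : (ρ 0 0).im = 0 := by linarith [h00.2]
  have i11 : (ρ 1 1).im = 0 := by linarith [h11.2]
  refine ⟨!₂[2 * (ρ 0 1).re, -2 * (ρ 0 1).im, (ρ 0 0).re - (ρ 1 1).re], ?_, fun n ↦ ?_⟩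
  · rw [EuclideanSpace.norm_eq, Real.sqrt_le_iff]
    refine ⟨zero_le_one, ?_⟩
    simp only [Fin.sum_univ_three, Real.norm_eq_abs, sq_abs, cons_val]
    have h := hdet.1
    rw [← h10.1, ← h10.2, i00, i11] at h
    have hsq : ((ρ 0 0).re + (ρ 1 1).re) ^ 2 = 1 := by rw [htr.1]; norm_num
    nlinarith
  · rw [PiLp.inner_apply, Fin.sum_univ_three, trace_fin_two, Matrix.mul_apply, Matrix.mul_apply,
      Fin.sum_univ_two, Fin.sum_univ_two]
    apply Complex.ext <;>
      simp [dotSigma, pauli1, pauli2, pauli3, i00, i11, ← h10.1, ← h10.2] <;> ring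

/-- A signed sum of products of coordinates along two orthonormal families is bounded by one
on the product of the unit balls. -/
lemma Orthonormal.abs_sum_sign_mul_inner_le_one {ι E F : Type*} [Fintype ι]
    [NormedAddCommGroup E] [InnerProductSpace ℝ E] [NormedAddCommGroup F] [InnerProductSpace ℝ F]
    {a : ι → E} {b : ι → F} (ha : Orthonormal ℝ a) (hb : Orthonormal ℝ b)
    {ε : ι → ℝ} (hε : ∀ i, |ε i| = 1) {r : E} {s : F} (hr : ‖r‖ ≤ 1) (hs : ‖s‖ ≤ 1) :
    |∑ i, ε i * (inner ℝ (a i) r * inner ℝ (b i) s)| ≤ 1 := by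
  have hA := ha.sum_inner_products_le r (s := Finset.univ)
  have hB := hb.sum_inner_products_le s (s := Finset.univ)
  simp only [Real.norm_eq_abs, sq_abs] at hA hB
  calc |∑ i, ε i * (inner ℝ (a i) r * inner ℝ (b i) s)|
      ≤ ∑ i, |ε i * (inner ℝ (a i) r * inner ℝ (b i) s)| := Finset.abs_sum_le_sum_abs _ _
    _ ≤ ∑ i, (inner ℝ (a i) r ^ 2 + inner ℝ (b i) s ^ 2) / 2 := by
        gcongr with i
        rw [abs_mul, hε, one_mul, abs_mul]
        nlinarith [sq_nonneg (|inner ℝ (a i) r| - |inner ℝ (b i) s|),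
          sq_abs (inner ℝ (a i) r), sq_abs (inner ℝ (b i) s)]
    _ = (∑ i, inner ℝ (a i) r ^ 2 + ∑ i, inner ℝ (b i) s ^ 2) / 2 := by
        rw [← Finset.sum_div, Finset.sum_add_distrib]
    _ ≤ 1 := by nlinarith [norm_nonneg r, norm_nonneg s]

/-- signed-permutation generalization of the Lemma of Appendix C:
for orthonormal bases `a, b` of `ℝ³`, a permutation `π` of `{0,1,2}`, signs
`ε i ∈ {−1,1}` and any separable two-qubit density matrix `ρ`,
`|Re Tr((∑ i ε i · A i ⊗ B (π i)) ρ)| ≤ 1`. -/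
theorem persistency_stmt3
    (a b : Fin 3 → EuclideanSpace ℝ (Fin 3))
    (ha : Orthonormal ℝ a) (hb : Orthonormal ℝ b)
    (π : Equiv.Perm (Fin 3)) (ε : Fin 3 → ℝ) (hε : ∀ i, ε i = 1 ∨ ε i = -1)
    (ρ : Matrix (Fin 2 × Fin 2) (Fin 2 × Fin 2) ℂ)
    (hρ : IsSeparableTwoQubit ρ) :
    |(((∑ i : Fin 3, (ε i : ℂ) • (dotSigma (a i) ⊗ₖ dotSigma (b (π i)))) * ρ).trace.re)| ≤ 1 := by
  obtain ⟨n, p, ρA, ρB, hp, hp1, hA, hB, rfl⟩ := hρ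
  choose r hr hrA using fun k ↦ (hA k).exists_bloch_vector
  choose s hs hsB using fun k ↦ (hB k).exists_bloch_vector
  have hε' : ∀ i, |ε i| = 1 := fun i ↦ by rcases hε i with h | h <;> simp [h]
  have key : ((∑ i : Fin 3, (ε i : ℂ) • (dotSigma (a i) ⊗ₖ dotSigma (b (π i)))) *
      ∑ k, (p k : ℂ) • (ρA k ⊗ₖ ρB k)).trace =
      ((∑ k, p k * ∑ i, ε i * (inner ℝ (a i) (r k) * inner ℝ (b (π i)) (s k)) : ℝ) : ℂ) := by
    simp only [Finset.mul_sum, Finset.sum_mul, trace_sum, smul_mul_assoc, mul_smul_comm,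
      trace_smul, ← mul_kronecker_mul, trace_kronecker, hrA, hsB, smul_eq_mul]
    push_cast
    rfl
  rw [key, Complex.ofReal_re]
  calc |∑ k, p k * ∑ i, ε i * (inner ℝ (a i) (r k) * inner ℝ (b (π i)) (s k))|
      ≤ ∑ k, |p k * ∑ i, ε i * (inner ℝ (a i) (r k) * inner ℝ (b (π i)) (s k))| :=
        Finset.abs_sum_le_sum_abs _ _
    _ ≤ ∑ k, p k := by
        gcongr with k
        rw [abs_mul, abs_of_nonneg (hp k)]
        exact mul_le_of_le_one_right (hp k)
          (ha.abs_sum_sign_mul_inner_le_one (hb.comp π π.injective) hε' (hr k) (hs k))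
    _ = 1 := hp1
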